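/- Let p,p' ∈ ℕ₀ and q,q' ∈ ℕ with p < p' and q' < q. Then the canonical inclusion B^{p',q'}_N ⊂ B^{p,q}_N is a compact operator. -/

import Mathlib

open MeasureTheory Filter Asymptotics

noncomputable section

/-- The Heisenberg group `ℍ`: `ℝ³` with the polarised group law
`(x,y,z) * (x',y',z') = (x+x', y+y', z+z'+x·y')`. -/
abbrev Heis : Type := ℝ × ℝ × ℝ

/-- The group law of the Heisenberg group. -/
def hmul (g g' : Heis) : Heis :=
  (g.1 + g'.1, g.2.1 + g'.2.1, g.2.2 + g'.2.2 + g.1 * g'.2.1)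

/-- The Lie bracket on the Lie algebra `ℝ³` of the Heisenberg group. -/
def hbracket (v w : ℝ × ℝ × ℝ) : ℝ × ℝ × ℝ :=
  (0, 0, v.1 * w.2.1 - w.1 * v.2.1)

/-- The exponential map of the Heisenberg group. -/
def hexp (v : ℝ × ℝ × ℝ) : Heis := (v.1, v.2.1, v.2.2 + v.1 * v.2.1 / 2)

/-- The inverse of the exponential map. -/
def hlog (g : Heis) : ℝ × ℝ × ℝ := (g.1, g.2.1, g.2.2 - g.1 * g.2.1 / 2)

/-- The basis element `X` of the Lie algebra. -/
def Xvec : ℝ × ℝ × ℝ := (1, 0, 0)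

/-- The basis element `Y` of the Lie algebra. -/
def Yvec : ℝ × ℝ × ℝ := (0, 1, 0)

/-- The central element `Z` of the Lie algebra. -/
def Zvec : ℝ × ℝ × ℝ := (0, 0, 1)

/-- The lattice `Γ_K = {(x, y, z/K) : x,y,z ∈ ℤ}`. -/
def GammaK (K : ℕ) : Set Heis :=
  {g | ∃ x y z : ℤ, g = ((x : ℝ), (y : ℝ), (z : ℝ) / K)}

/-- The flow generated by the left-invariant vector field associated to `U`:
`m ↦ m * exp (t U)`. -/
def hflow (U : ℝ × ℝ × ℝ) (t : ℝ) (m : Heis) : Heis := hmul m (hexp (t • U))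

/-- The action of the left-invariant vector field associated to `U` on functions. -/
def VF (U : ℝ × ℝ × ℝ) (h : Heis → ℂ) (m : Heis) : ℂ :=
  deriv (fun t : ℝ => h (hflow U t m)) 0

/-- `C^∞(M)`: smooth `Γ_K`-invariant functions on `ℍ` (functions on `M = Γ_K\ℍ`). -/
def SmoothM (K : ℕ) (h : Heis → ℂ) : Prop :=
  ContDiff ℝ (⊤ : ℕ∞) h ∧ ∀ γ ∈ GammaK K, ∀ m : Heis, h (hmul γ m) = h m

/-- `C^q(M)`: `C^q` `Γ_K`-invariant functions on `ℍ`. -/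
def CqM (K : ℕ) (q : ℕ) (g : Heis → ℂ) : Prop :=
  ContDiff ℝ q g ∧ ∀ γ ∈ GammaK K, ∀ m : Heis, g (hmul γ m) = g m

/-- `C^∞_N = {h ∈ C^∞(M) : Z h = 2πiNK·h}`. -/
def CN (K : ℕ) (N : ℤ) (h : Heis → ℂ) : Prop :=
  SmoothM K h ∧ VF Zvec h = fun m => (2 * Real.pi * Complex.I * N * K) * h m

/-- The `C^r` norm `‖f‖_{C^r} = sup_{k ≤ r} 2^{r-k} sup |f^{(k)}|` of a function on `ℝ`. -/
def CrNorm (r : ℕ) (η : ℝ → ℂ) : ℝ :=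
  ⨆ k : Fin (r + 1), (2 : ℝ) ^ (r - (k : ℕ)) * ⨆ t : ℝ, ‖iteratedDeriv (k : ℕ) η t‖

/-- The `C^r` norm of a function on `M`. -/
def MCrNorm (r : ℕ) (g : Heis → ℂ) : ℝ :=
  ⨆ k : Fin (r + 1), (2 : ℝ) ^ (r - (k : ℕ)) * ⨆ m : Heis, ‖iteratedFDeriv ℝ (k : ℕ) g m‖

/-- Test functions: `C^∞` functions with support compactly contained in `(-δ, δ)`. -/
def TestFun (δ : ℝ) (η : ℝ → ℂ) : Prop :=
  ContDiff ℝ (⊤ : ℕ∞) η ∧ HasCompactSupport η ∧ tsupport η ⊆ Set.Ioo (-δ) δ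

/-- The linear functional `ℓ_{η,m}(h) = ∫_{-δ}^{δ} η(t)·h(φ_t^W(m)) dt`. -/
def ell (Wd : ℝ × ℝ × ℝ) (δ : ℝ) (η : ℝ → ℂ) (m : Heis) (h : Heis → ℂ) : ℂ :=
  ∫ t in (-δ)..δ, η t * h (hflow Wd t m)

/-- The seminorm `|h|_{j,q}`. -/
def semiNorm (Vd Wd : ℝ × ℝ × ℝ) (δ : ℝ) (j q : ℕ) (h : Heis → ℂ) : ℝ :=
  sSup {x : ℝ | ∃ m : Heis, ∃ η : ℝ → ℂ, TestFun δ η ∧ CrNorm q η ≤ 1 ∧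
    x = ‖ell Wd δ η m ((VF Vd)^[j] h)‖}

/-- The anisotropic norm `‖h‖_{p,q}`. -/
def pqNorm (Vd Wd : ℝ × ℝ × ℝ) (δ : ℝ) (p q : ℕ) (h : Heis → ℂ) : ℝ :=
  sSup {x : ℝ | ∃ j : ℕ, j ≤ p ∧ ∃ m : Heis, ∃ η : ℝ → ℂ, TestFun δ η ∧ CrNorm q η ≤ 1 ∧
    x = ‖ell Wd δ η m ((VF Vd)^[j] h)‖}

/-- Integration over `M = Γ_K\ℍ` with respect to the probability measure `ν`
inherited from the Haar measure, computed on the fundamental domain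
`[0,1) × [0,1) × [0,1/K)` (rescaled by `K` to have total mass one). -/
def nuInt (K : ℕ) (f : Heis → ℂ) : ℂ :=
  (K : ℂ) * (∫ m in (Set.Icc (0 : ℝ) 1 ×ˢ (Set.Icc (0 : ℝ) 1 ×ˢ Set.Icc (0 : ℝ) (1 / K))), f m)

/-- The setting of the paper: a Heisenberg nilmanifold `M = Γ_K\ℍ`, a partially
hyperbolic automorphism `Φ` with `Φ_* V = λ⁻¹ V`, `Φ_* W = λ W`, `Φ_* Z = Z` for a
Heisenberg frame `{V, W, Z}`, and a fixed small `δ > 0`. -/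
structure NilSetting where
  K : ℕ
  hK : 0 < K
  lam : ℝ
  hlam : 1 < lam
  Vd : ℝ × ℝ × ℝ
  Wd : ℝ × ℝ × ℝ
  frame : hbracket Vd Wd = Zvec
  Φ : Heis → Heis
  Φbij : Function.Bijective Φ
  Φhom : ∀ g g' : Heis, Φ (hmul g g') = hmul (Φ g) (Φ g')
  Φlattice : Φ '' GammaK K = GammaK K
  ΦV : ∀ t : ℝ, Φ (hexp (t • Vd)) = hexp ((lam⁻¹ * t) • Vd)
  ΦW : ∀ t : ℝ, Φ (hexp (t • Wd)) = hexp ((lam * t) • Wd)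
  ΦZ : ∀ t : ℝ, Φ (hexp (t • Zvec)) = hexp (t • Zvec)
  δ : ℝ
  hδ : 0 < δ

namespace NilSetting

/-- The transfer operator `L : h ↦ h ∘ Φ`. -/
def L (S : NilSetting) (h : Heis → ℂ) : Heis → ℂ := fun m => h (S.Φ m)

/-- The space `C^∞_N` as a set of functions. -/
def cn (S : NilSetting) (N : ℤ) : Set (Heis → ℂ) := {h | CN S.K N h}

/-- The anisotropic norm `‖·‖_{p,q}` of the setting. -/
def nrm (S : NilSetting) (p q : ℕ) (h : Heis → ℂ) : ℝ := pqNorm S.Vd S.Wd S.δ p q h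

/-- The seminorm `|·|_{j,q}` of the setting. -/
def snrm (S : NilSetting) (j q : ℕ) (h : Heis → ℂ) : ℝ := semiNorm S.Vd S.Wd S.δ j q h

end NilSetting

/-- `(B, j)` is a realisation of the completion of `Sset` with respect to the
norm `Nrm`: `j` is linear and isometric on `Sset` and has dense image. -/
def IsCompletion (Nrm : (Heis → ℂ) → ℝ) (Sset : Set (Heis → ℂ))
    {B : Type} [NormedAddCommGroup B] [NormedSpace ℂ B] (j : (Heis → ℂ) → B) : Prop :=
  CompleteSpace B ∧
  (∀ h ∈ Sset, ∀ h' ∈ Sset, j (h + h') = j h + j h') ∧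
  (∀ (c : ℂ), ∀ h ∈ Sset, j (c • h) = c • j h) ∧
  (∀ h ∈ Sset, ‖j h‖ = Nrm h) ∧
  Dense (j '' Sset)


theorem exists_compact_extension {E B B' : Type*} [AddCommGroup E] [Module ℂ E]
    [NormedAddCommGroup B] [NormedSpace ℂ B] [CompleteSpace B]
    [NormedAddCommGroup B'] [NormedSpace ℂ B']
    (J : E →ₗ[ℂ] B) (J' : E →ₗ[ℂ] B') (hJ' : DenseRange J')
    (H : ∀ ε > 0, ∃ (ι : Type) (_ : Fintype ι) (Λ : E →ₗ[ℂ] (ι → ℂ)), ∀ h,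
      ‖Λ h‖ ≤ ‖J' h‖ ∧ ‖J h‖ ≤ ‖Λ h‖ + ε * ‖J' h‖) :
    ∃ T : B' →L[ℂ] B, (∀ h, T (J' h) = J h) ∧ IsCompactOperator T := by
  have hbd : ∃ C : ℝ, ∀ x, ‖J x‖ ≤ C * ‖J' x‖ := by
    obtain ⟨ι, _, Λ, hΛ⟩ := H 1 one_pos
    exact ⟨2, fun x => by linarith [(hΛ x).1, (hΛ x).2]⟩
  have hT : ∀ h, J.extendOfNorm J' (J' h) = J h :=
    LinearMap.extendOfNorm_eq hJ' hbd
  refine ⟨J.extendOfNorm J', hT, ?_⟩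
  set T := J.extendOfNorm J'
  refine (isCompactOperator_iff_isCompact_closure_image_ball (T : B' →ₗ[ℂ] B) one_pos).2 ?_
  refine TotallyBounded.isCompact_of_isClosed ?_ isClosed_closure
  rw [totallyBounded_closure, Metric.totallyBounded_iff]
  intro ε hε
  obtain ⟨ι, _, Λ, hΛ⟩ := H (ε / 4) (by positivity)
  have hΛbd : ∀ x, ‖Λ x‖ ≤ 1 * ‖J' x‖ := fun x => by rw [one_mul]; exact (hΛ x).1
  set L := Λ.extendOfNorm J'
  have hL : ∀ h, L (J' h) = Λ h := LinearMap.extendOfNorm_eq hJ' ⟨1, hΛbd⟩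
  have key : ∀ x, ‖T x‖ ≤ ‖L x‖ + ε / 4 * ‖x‖ := by
    intro x
    refine hJ'.induction_on (p := fun x => ‖T x‖ ≤ ‖L x‖ + ε / 4 * ‖x‖) x ?_ ?_
    · exact isClosed_le (by fun_prop) (by fun_prop)
    · intro h
      rw [hT, hL]
      exact (hΛ h).2
  have hLn : ∀ x, ‖L x‖ ≤ 1 * ‖x‖ := LinearMap.norm_extendOfNorm_apply_le hJ' 1 hΛbd
  have htb : TotallyBounded (L '' Metric.ball 0 1) := by
    refine (isCompact_closedBall (0 : ι → ℂ) 1).totallyBounded.subset ?_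
    rintro _ ⟨x, hx, rfl⟩
    rw [mem_ball_zero_iff] at hx
    rw [mem_closedBall_zero_iff]
    linarith [hLn x]
  obtain ⟨t, hts, htf, htc⟩ := Metric.finite_approx_of_totallyBounded htb (ε / 2) (by positivity)
  obtain ⟨u, hub, huf, rfl⟩ :=
    (Set.exists_subset_image_finite_and (p := fun s => s = t)).1 ⟨t, hts, htf, rfl⟩
  refine ⟨T '' u, huf.image _, ?_⟩
  rintro _ ⟨x, hx, rfl⟩
  have := htc ⟨x, hx, rfl⟩
  simp only [Set.mem_iUnion, Set.mem_image, exists_prop, exists_exists_and_eq_and] at this ⊢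
  obtain ⟨y, hy, hxy⟩ := this
  refine ⟨y, hy, ?_⟩
  have hy' := hub hy
  rw [mem_ball_zero_iff] at hx hy'
  rw [mem_ball_iff_norm, ← map_sub] at hxy
  have h2 := norm_sub_le x y
  rw [mem_ball_iff_norm]
  change ‖T x - T y‖ < ε
  rw [← map_sub]
  nlinarith [key (x - y)]

theorem hflow_eq (U : ℝ × ℝ × ℝ) (t : ℝ) (m : Heis) :
    hflow U t m = (m.1 + t * U.1, m.2.1 + t * U.2.1,
      m.2.2 + (t * U.2.2 + t * U.1 * (t * U.2.1) / 2) + m.1 * (t * U.2.1)) := by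
  simp [hflow, hmul, hexp]

theorem hflow_hflow (U : ℝ × ℝ × ℝ) (s t : ℝ) (m : Heis) :
    hflow U s (hflow U t m) = hflow U (t + s) m := by
  simp only [hflow_eq, Prod.mk.injEq]
  refine ⟨?_, ?_, ?_⟩ <;> ring

theorem hflow_zero (U : ℝ × ℝ × ℝ) (m : Heis) : hflow U 0 m = m := by
  simp [hflow_eq]

theorem hflow_hmul (U : ℝ × ℝ × ℝ) (t : ℝ) (g m : Heis) :
    hflow U t (hmul g m) = hmul g (hflow U t m) := by
  simp only [hflow_eq, hmul, Prod.mk.injEq]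
  refine ⟨?_, ?_, ?_⟩ <;> ring

theorem hflow_Zvec (c : ℝ) (m : Heis) : hflow Zvec c m = (m.1, m.2.1, m.2.2 + c) := by
  simp [hflow_eq, Zvec]

theorem hflow_Zvec_comm (U : ℝ × ℝ × ℝ) (t c : ℝ) (m : Heis) :
    hflow U t (hflow Zvec c m) = hflow Zvec c (hflow U t m) := by
  simp only [hflow_eq, Zvec, Prod.mk.injEq]
  refine ⟨?_, ?_, ?_⟩ <;> ring

theorem hflow_comm {V W : ℝ × ℝ × ℝ} (hVW : hbracket V W = Zvec) (s t : ℝ) (m : Heis) :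
    hflow W t (hflow V s m) = hflow Zvec (s * t) (hflow V s (hflow W t m)) := by
  have h : V.1 * W.2.1 - W.1 * V.2.1 = 1 := by simpa [hbracket, Zvec] using hVW
  simp only [hflow_eq, Zvec, Prod.mk.injEq]
  refine ⟨by ring, by ring, ?_⟩
  linear_combination s * t * h

theorem continuous_hflow (U : ℝ × ℝ × ℝ) : Continuous fun p : ℝ × Heis => hflow U p.1 p.2 := by
  simp only [hflow_eq]
  fun_prop

theorem hasDerivAt_hflow_zero (U : ℝ × ℝ × ℝ) (m : Heis) :
    HasDerivAt (fun t : ℝ => hflow U t m) (U.1, U.2.1, U.2.2 + m.1 * U.2.1) 0 := by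
  simp only [hflow_eq]
  have h1 : ∀ a : ℝ, HasDerivAt (fun t : ℝ => t * a) a 0 := fun a => by
    simpa using (hasDerivAt_id (0 : ℝ)).mul_const a
  refine HasDerivAt.prodMk ?_ (HasDerivAt.prodMk ?_ ?_)
  · exact (h1 _).const_add _
  · exact (h1 _).const_add _
  · have := (((h1 U.2.2).add (((h1 U.1).mul (h1 U.2.1)).div_const 2)).const_add m.2.2).add
      ((h1 U.2.1).const_mul m.1)
    exact this.congr_deriv (by ring)

theorem hasDerivAt_comp_hflow_zero {f : Heis → ℂ} (hf : Differentiable ℝ f) (U : ℝ × ℝ × ℝ)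
    (m : Heis) : HasDerivAt (fun t : ℝ => f (hflow U t m))
      (fderiv ℝ f m (U.1, U.2.1, U.2.2 + m.1 * U.2.1)) 0 := by
  have h := hasDerivAt_hflow_zero U m
  have h0 : HasFDerivAt f (fderiv ℝ f m) (hflow U 0 m) := by
    rw [hflow_zero]; exact (hf m).hasFDerivAt
  exact h0.comp_hasDerivAt 0 h

theorem VF_eq_fderiv {f : Heis → ℂ} (hf : Differentiable ℝ f) (U : ℝ × ℝ × ℝ) (m : Heis) :
    VF U f m = fderiv ℝ f m (U.1, U.2.1, U.2.2 + m.1 * U.2.1) :=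
  (hasDerivAt_comp_hflow_zero hf U m).deriv

theorem hasDerivAt_comp_hflow {f : Heis → ℂ} (hf : Differentiable ℝ f) (U : ℝ × ℝ × ℝ)
    (m : Heis) (s : ℝ) :
    HasDerivAt (fun t : ℝ => f (hflow U t m)) (VF U f (hflow U s m)) s := by
  have h := hasDerivAt_comp_hflow_zero hf U (hflow U s m)
  rw [← VF_eq_fderiv hf] at h
  have h' : HasDerivAt (fun t : ℝ => f (hflow U t (hflow U s m)))
    (VF U f (hflow U s m)) (s - s) := by rwa [sub_self]
  have h2 := h'.comp_sub_const s s
  simpa only [hflow_hflow, add_sub_cancel] using h2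

theorem contDiff_VF {f : Heis → ℂ} (hf : ContDiff ℝ (⊤ : ℕ∞) f) (U : ℝ × ℝ × ℝ) :
    ContDiff ℝ (⊤ : ℕ∞) (VF U f) := by
  have hd : Differentiable ℝ f := hf.differentiable (by simp)
  have : VF U f = fun m => fderiv ℝ f m (U.1, U.2.1, U.2.2 + m.1 * U.2.1) :=
    funext (VF_eq_fderiv hd U)
  rw [this]
  have h1 : ContDiff ℝ (⊤ : ℕ∞) (fderiv ℝ f) := hf.fderiv_right (by simp)
  exact h1.clm_apply (by fun_prop)

theorem VF_add {f g : Heis → ℂ} (hf : Differentiable ℝ f) (hg : Differentiable ℝ g)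
    (U : ℝ × ℝ × ℝ) : VF U (f + g) = VF U f + VF U g := by
  ext m
  rw [Pi.add_apply, VF_eq_fderiv hf, VF_eq_fderiv hg, VF_eq_fderiv (hf.add hg),
    fderiv_add (hf m) (hg m)]
  rfl

theorem VF_smul {f : Heis → ℂ} (hf : Differentiable ℝ f) (c : ℂ) (U : ℝ × ℝ × ℝ) :
    VF U (c • f) = c • VF U f := by
  ext m
  rw [Pi.smul_apply, VF_eq_fderiv hf, VF_eq_fderiv (hf.const_smul c),
    fderiv_const_smul (hf m)]
  rfl

/-- Every point can be moved into the unit square by the lattice and the centre. -/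
theorem exists_lattice_reduction (K : ℕ) (m : Heis) :
    ∃ γ ∈ GammaK K, ∃ c x y : ℝ, x ∈ Set.Icc (0 : ℝ) 1 ∧ y ∈ Set.Icc (0 : ℝ) 1 ∧
      m = hmul γ (hflow Zvec c (x, y, 0)) := by
  refine ⟨(((⌊m.1⌋ : ℤ) : ℝ), ((⌊m.2.1⌋ : ℤ) : ℝ), ((0 : ℤ) : ℝ) / K), ⟨_, _, _, rfl⟩,
    m.2.2 - ⌊m.1⌋ * Int.fract m.2.1, Int.fract m.1, Int.fract m.2.1,
    ⟨Int.fract_nonneg _, (Int.fract_lt_one _).le⟩,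
    ⟨Int.fract_nonneg _, (Int.fract_lt_one _).le⟩, ?_⟩
  rw [hflow_Zvec]
  simp [hmul]

/-- Smooth `Γ_K`-invariant functions on which the centre acts through the character
`c ↦ exp (lam * c)`. -/
structure IsCentralEigen (K : ℕ) (lam : ℂ) (f : Heis → ℂ) : Prop where
  contDiff : ContDiff ℝ (⊤ : ℕ∞) f
  invariant : ∀ γ ∈ GammaK K, ∀ m : Heis, f (hmul γ m) = f m
  central : ∀ (m : Heis) (c : ℝ), f (hflow Zvec c m) = Complex.exp (lam * c) * f m

namespace IsCentralEigen

variable {K : ℕ} {lam : ℂ} {f : Heis → ℂ}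

theorem differentiable (hf : IsCentralEigen K lam f) : Differentiable ℝ f :=
  hf.contDiff.differentiable (by simp)

theorem vf (hf : IsCentralEigen K lam f) (U : ℝ × ℝ × ℝ) : IsCentralEigen K lam (VF U f) where
  contDiff := contDiff_VF hf.contDiff U
  invariant γ hγ m := by simp only [VF, hflow_hmul, hf.invariant γ hγ]
  central m c := by
    simp only [VF, hflow_Zvec_comm, hf.central]
    exact deriv_const_mul _ (hasDerivAt_comp_hflow hf.differentiable U m 0).differentiableAt

theorem vf_iterate (hf : IsCentralEigen K lam f) (U : ℝ × ℝ × ℝ) (j : ℕ) :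
    IsCentralEigen K lam ((VF U)^[j] f) := by
  induction j with
  | zero => exact hf
  | succ j ih => rw [Function.iterate_succ_apply']; exact ih.vf U

theorem norm_central (hf : IsCentralEigen K lam f) (hlam : lam.re = 0) (m : Heis) (c : ℝ) :
    ‖f (hflow Zvec c m)‖ = ‖f m‖ := by
  rw [hf.central, norm_mul, Complex.norm_exp]
  simp [hlam]

theorem exists_norm_le (hf : IsCentralEigen K lam f) (hlam : lam.re = 0) :
    ∃ C : ℝ, ∀ m, ‖f m‖ ≤ C := by
  have hc : IsCompact (Set.Icc (0 : ℝ) 1 ×ˢ (Set.Icc (0 : ℝ) 1 ×ˢ {(0 : ℝ)})) :=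
    isCompact_Icc.prod (isCompact_Icc.prod isCompact_singleton)
  obtain ⟨C, hC⟩ := hc.exists_bound_of_continuousOn hf.contDiff.continuous.continuousOn
  refine ⟨C, fun m => ?_⟩
  obtain ⟨γ, hγ, c, x, y, hx, hy, rfl⟩ := exists_lattice_reduction K m
  rw [hf.invariant γ hγ, hf.norm_central hlam]
  exact hC _ ⟨hx, hy, rfl⟩

end IsCentralEigen

theorem CN.isCentralEigen {K : ℕ} {N : ℤ} {h : Heis → ℂ} (hh : CN K N h) :
    IsCentralEigen K (2 * Real.pi * Complex.I * N * K) h where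
  contDiff := hh.1.1
  invariant := hh.1.2
  central m c := by
    set lam : ℂ := 2 * Real.pi * Complex.I * N * K with hlam
    have hd : Differentiable ℝ h := hh.1.1.differentiable (by simp)
    have h1 : ∀ c : ℝ, HasDerivAt
        (fun c : ℝ => Complex.exp (-(lam * c)) * h (hflow Zvec c m)) 0 c := by
      intro c
      have h2 := hasDerivAt_comp_hflow hd Zvec m c
      rw [hh.2] at h2
      have h3 : HasDerivAt (fun c : ℝ => -(lam * (c : ℂ))) (-(lam * 1)) c :=
        ((Complex.ofRealCLM.hasDerivAt (x := c)).const_mul lam).neg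
      exact (h3.cexp.mul h2).congr_deriv (by ring)
    have h4 := is_const_of_deriv_eq_zero (fun c => (h1 c).differentiableAt)
      (fun c => (h1 c).deriv) c 0
    simp only [hflow_zero, Complex.ofReal_zero, mul_zero, neg_zero, Complex.exp_zero, one_mul,
      Complex.exp_neg] at h4
    rw [← h4, mul_inv_cancel_left₀ (Complex.exp_ne_zero _)]

theorem TestFun.of_tsupport_subset {δ : ℝ} {η : ℝ → ℂ} (h : ContDiff ℝ (⊤ : ℕ∞) η)
    (hs : tsupport η ⊆ Set.Ioo (-δ) δ) : TestFun δ η :=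
  ⟨h, isCompact_Icc.of_isClosed_subset (isClosed_tsupport η)
    (hs.trans Set.Ioo_subset_Icc_self), hs⟩

theorem HasCompactSupport.iteratedDeriv_real {η : ℝ → ℂ} (h : HasCompactSupport η) (k : ℕ) :
    HasCompactSupport (iteratedDeriv k η) := by
  induction k with
  | zero => simpa using h
  | succ k ih => rw [iteratedDeriv_succ]; exact ih.deriv

theorem tsupport_iteratedDeriv_subset_tsupport (η : ℝ → ℂ) (k : ℕ) :
    tsupport (iteratedDeriv k η) ⊆ tsupport η := by
  induction k with
  | zero => simp
  | succ k ih => rw [iteratedDeriv_succ]; exact tsupport_deriv_subset.trans ih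

namespace TestFun

variable {δ : ℝ} {η ζ : ℝ → ℂ}

theorem sub (hη : TestFun δ η) (hζ : TestFun δ ζ) : TestFun δ (η - ζ) := by
  refine of_tsupport_subset (hη.1.sub hζ.1) ?_
  refine (closure_minimal ((Function.support_sub η ζ).trans ?_)
    ((isClosed_tsupport η).union (isClosed_tsupport ζ))).trans (Set.union_subset hη.2.2 hζ.2.2)
  exact Set.union_subset_union (subset_tsupport η) (subset_tsupport ζ)

theorem mul_left (hη : TestFun δ η) {g : ℝ → ℂ} (hg : ContDiff ℝ (⊤ : ℕ∞) g) :
    TestFun δ (g * η) :=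
  of_tsupport_subset (hg.mul hη.1) (tsupport_mul_subset_right.trans hη.2.2)

theorem smul (hη : TestFun δ η) (c : ℂ) : TestFun δ (c • η) :=
  hη.mul_left (g := fun _ => c) contDiff_const

theorem exists_comp_sub (hη : TestFun δ η) :
    ∃ β > 0, ∀ b : ℝ, |b| < β → TestFun δ fun t => η (t - b) := by
  obtain ⟨β, hβ, hsub⟩ := IsCompact.exists_thickening_subset_open hη.2.1 isOpen_Ioo hη.2.2
  refine ⟨β, hβ, fun b hb => of_tsupport_subset (hη.1.comp (by fun_prop)) ?_⟩
  have h1 : tsupport (fun t => η (t - b)) ⊆ (fun t => t - b) ⁻¹' tsupport η :=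
    closure_minimal (fun t ht => subset_tsupport η ht)
      ((isClosed_tsupport η).preimage (by fun_prop))
  refine fun t ht => hsub (Metric.mem_thickening_iff.2 ⟨t - b, h1 ht, ?_⟩)
  rw [Real.dist_eq]
  simpa using hb

theorem continuous_iteratedDeriv (hη : TestFun δ η) (k : ℕ) : Continuous (iteratedDeriv k η) :=
  hη.1.continuous_iteratedDeriv k (by exact_mod_cast le_top)

theorem iteratedDeriv_eq_zero (hη : TestFun δ η) (k : ℕ) {t : ℝ} (ht : t ∉ Set.Ioo (-δ) δ) :
    iteratedDeriv k η t = 0 :=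
  image_eq_zero_of_notMem_tsupport fun h =>
    ht (hη.2.2 (tsupport_iteratedDeriv_subset_tsupport η k h))

theorem bddAbove_norm_iteratedDeriv (hη : TestFun δ η) (k : ℕ) :
    BddAbove (Set.range fun t => ‖iteratedDeriv k η t‖) := by
  obtain ⟨C, hC⟩ := (hη.2.1.iteratedDeriv_real k).exists_bound_of_continuous
    (hη.continuous_iteratedDeriv k)
  exact ⟨C, by rintro _ ⟨t, rfl⟩; exact hC t⟩

theorem norm_iteratedDeriv_le_CrNorm (hη : TestFun δ η) {k r : ℕ} (hk : k ≤ r) (t : ℝ) :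
    ‖iteratedDeriv k η t‖ ≤ CrNorm r η := by
  have h1 : ‖iteratedDeriv k η t‖ ≤ ⨆ t : ℝ, ‖iteratedDeriv k η t‖ :=
    le_ciSup (hη.bddAbove_norm_iteratedDeriv k) t
  have h2 : (2 : ℝ) ^ (r - k) * (⨆ t : ℝ, ‖iteratedDeriv k η t‖) ≤ CrNorm r η :=
    le_ciSup (f := fun k : Fin (r + 1) =>
      (2 : ℝ) ^ (r - (k : ℕ)) * ⨆ t : ℝ, ‖iteratedDeriv (k : ℕ) η t‖)
      (Set.finite_range _).bddAbove ⟨k, by omega⟩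
  have h3 : (1 : ℝ) ≤ 2 ^ (r - k) := one_le_pow₀ (by norm_num)
  nlinarith [norm_nonneg (iteratedDeriv k η t)]

theorem norm_le_CrNorm (hη : TestFun δ η) (r : ℕ) (t : ℝ) : ‖η t‖ ≤ CrNorm r η := by
  simpa using hη.norm_iteratedDeriv_le_CrNorm (Nat.zero_le r) t

end TestFun

theorem CrNorm_nonneg (r : ℕ) (η : ℝ → ℂ) : 0 ≤ CrNorm r η :=
  Real.iSup_nonneg fun _ => mul_nonneg (by positivity) (Real.iSup_nonneg fun _ => norm_nonneg _)

theorem CrNorm_le {r : ℕ} {η : ℝ → ℂ} {c : ℝ}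
    (h : ∀ k ≤ r, ∀ t, ‖iteratedDeriv k η t‖ ≤ c) : CrNorm r η ≤ 2 ^ r * c := by
  refine ciSup_le fun k => mul_le_mul ?_ (ciSup_le fun t => h k (by omega) t)
    (Real.iSup_nonneg fun _ => norm_nonneg _) (by positivity)
  exact pow_le_pow_right₀ (by norm_num) (Nat.sub_le _ _)

theorem CrNorm_mono {q q' : ℕ} (hq : q' ≤ q) (η : ℝ → ℂ) : CrNorm q' η ≤ CrNorm q η := by
  refine ciSup_le fun k => ?_
  refine le_trans ?_ (le_ciSup (f := fun k : Fin (q + 1) =>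
      (2 : ℝ) ^ (q - (k : ℕ)) * ⨆ t : ℝ, ‖iteratedDeriv (k : ℕ) η t‖)
      (Set.finite_range _).bddAbove ⟨k, by omega⟩)
  refine mul_le_mul_of_nonneg_right ?_ (Real.iSup_nonneg fun _ => norm_nonneg _)
  exact pow_le_pow_right₀ (by norm_num) (by simp; omega)

theorem CrNorm_smul (r : ℕ) (c : ℂ) (η : ℝ → ℂ) : CrNorm r (c • η) = ‖c‖ * CrNorm r η := by
  unfold CrNorm
  rw [Real.mul_iSup_of_nonneg (norm_nonneg c)]
  congr 1
  ext k
  have : ∀ t, ‖iteratedDeriv (k : ℕ) (c • η) t‖ = ‖c‖ * ‖iteratedDeriv (k : ℕ) η t‖ := by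
    intro t
    rw [← norm_smul]
    congr 1
    exact iteratedDeriv_const_smul_field c η
  simp_rw [this, ← Real.mul_iSup_of_nonneg (norm_nonneg c)]
  ring

/-- The unit ball of test functions for the `C^q` norm is totally bounded for the `C^{q'}` norm. -/
theorem exists_finite_CrNorm_net {δ : ℝ} {q q' : ℕ} (hq : q' < q) {ε : ℝ} (hε : 0 < ε) :
    ∃ F : Set (ℝ → ℂ), F.Finite ∧ (∀ η ∈ F, TestFun δ η ∧ CrNorm q η ≤ 1) ∧
      ∀ η, TestFun δ η → CrNorm q η ≤ 1 → ∃ ζ ∈ F, CrNorm q' (η - ζ) ≤ ε := by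
  classical
  let X := BoundedContinuousFunction (Set.Icc (-δ) δ) ℂ
  let A : Set X := {g | (∀ x, g x ∈ Metric.closedBall (0 : ℂ) 1) ∧ LipschitzWith 1 g}
  have hA : TotallyBounded A := by
    refine (BoundedContinuousFunction.arzela_ascoli _ (isCompact_closedBall (0 : ℂ) 1) A
      (fun f x hf => hf.1 x) ?_).totallyBounded.subset subset_closure
    exact (LipschitzWith.uniformEquicontinuous (fun g : A => ((g : X) : Set.Icc (-δ) δ → ℂ)) 1
      fun g => g.2.2).equicontinuous
  have hPi : TotallyBounded (Set.univ.pi fun _ : Fin (q' + 1) => A) :=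
    (isCompact_univ_pi fun _ : Fin (q' + 1) =>
      hA.closure.isCompact_of_isClosed isClosed_closure).totallyBounded.subset
      (Set.pi_mono fun _ _ => subset_closure)
  let 𝒯 : Set (ℝ → ℂ) := {η | TestFun δ η ∧ CrNorm q η ≤ 1}
  let R : (ℝ → ℂ) → Fin (q' + 1) → X := fun η k =>
    if h : Continuous (iteratedDeriv (k : ℕ) η) then
      BoundedContinuousFunction.mkOfCompact
        ⟨fun x : Set.Icc (-δ) δ => iteratedDeriv (k : ℕ) η x, h.comp continuous_subtype_val⟩
    else 0
  have hR : ∀ η, TestFun δ η → ∀ k x, R η k x = iteratedDeriv (k : ℕ) η x := by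
    intro η hη k x
    simp only [R]
    rw [dif_pos (hη.continuous_iteratedDeriv k)]
    rfl
  have hRA : R '' 𝒯 ⊆ Set.univ.pi fun _ : Fin (q' + 1) => A := by
    rintro _ ⟨η, ⟨hη, hη1⟩, rfl⟩ k -
    refine ⟨fun x => ?_, ?_⟩
    · rw [hR η hη, mem_closedBall_zero_iff]
      exact (hη.norm_iteratedDeriv_le_CrNorm (by omega) _).trans hη1
    · have h1 : LipschitzWith 1 (iteratedDeriv (k : ℕ) η) := by
        refine lipschitzWith_of_nnnorm_deriv_le
          (hη.1.differentiable_iteratedDeriv k (by exact_mod_cast ENat.natCast_lt_top _)) fun t => ?_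
        rw [← iteratedDeriv_succ, ← NNReal.coe_le_coe, coe_nnnorm]
        exact (hη.norm_iteratedDeriv_le_CrNorm (by omega) _).trans hη1
      intro x y
      rw [hR η hη, hR η hη]
      exact h1 x y
  obtain ⟨t, hts, htf, htc⟩ := Metric.finite_approx_of_totallyBounded (hPi.subset hRA)
    (ε / 2 ^ q') (by positivity)
  obtain ⟨F, hF, hFf, rfl⟩ :=
    (Set.exists_subset_image_finite_and (p := fun s => s = t)).1 ⟨t, hts, htf, rfl⟩
  refine ⟨F, hFf, hF, fun η hη hη1 => ?_⟩
  have h1 := htc ⟨η, ⟨hη, hη1⟩, rfl⟩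
  simp only [Set.mem_iUnion, Set.mem_image, exists_prop, exists_exists_and_eq_and] at h1
  obtain ⟨ζ, hζF, hd⟩ := h1
  have hζ := (hF hζF).1
  refine ⟨ζ, hζF, ?_⟩
  have h2 : CrNorm q' (η - ζ) ≤ 2 ^ q' * (ε / 2 ^ q') := by
    refine CrNorm_le fun k hk s => ?_
    by_cases hs : s ∈ Set.Ioo (-δ) δ
    · have h3 : dist (R η ⟨k, by omega⟩ ⟨s, Set.Ioo_subset_Icc_self hs⟩)
          (R ζ ⟨k, by omega⟩ ⟨s, Set.Ioo_subset_Icc_self hs⟩) ≤ ε / 2 ^ q' :=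
        (BoundedContinuousFunction.dist_coe_le_dist _).trans
          ((dist_le_pi_dist (R η) (R ζ) _).trans (Metric.mem_ball.1 hd).le)
      rw [hR η hη, hR ζ hζ, dist_eq_norm] at h3
      rwa [iteratedDeriv_sub (hη.1.contDiffAt.of_le (by exact_mod_cast le_top))
        (hζ.1.contDiffAt.of_le (by exact_mod_cast le_top))]
    · rw [(hη.sub hζ).iteratedDeriv_eq_zero k hs, norm_zero]
      positivity
  rwa [mul_div_cancel₀ _ (by positivity)] at h2

theorem TestFun.exists_CrNorm_comp_sub_le {δ : ℝ} {η : ℝ → ℂ} (hη : TestFun δ η) (r : ℕ) {ε : ℝ}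
    (hε : 0 < ε) : ∃ β > 0, ∀ b : ℝ, |b| < β → TestFun δ (fun t => η (t - b)) ∧
      CrNorm r ((fun t => η (t - b)) - η) ≤ ε := by
  obtain ⟨β₀, hβ₀, h₀⟩ := hη.exists_comp_sub
  have h1 : ∀ k : ℕ, ∃ β > 0, ∀ b : ℝ, |b| < β → ∀ t,
      ‖iteratedDeriv k η (t - b) - iteratedDeriv k η t‖ ≤ ε / 2 ^ r := by
    intro k
    have huc := (hη.2.1.iteratedDeriv_real k).uniformContinuous_of_continuous
      (hη.continuous_iteratedDeriv k)
    obtain ⟨β, hβ, h⟩ := Metric.uniformContinuous_iff.1 huc (ε / 2 ^ r) (by positivity)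
    refine ⟨β, hβ, fun b hb t => ?_⟩
    rw [← dist_eq_norm]
    refine (h ?_).le
    rw [Real.dist_eq]
    simpa using hb
  choose β hβ h using h1
  have hmin : ∃ β' > 0, β' ≤ β₀ ∧ ∀ k ≤ r, β' ≤ β k := by
    refine ⟨min β₀ ((Finset.range (r + 1)).inf' ⟨0, by simp⟩ β), lt_min hβ₀ ?_,
      min_le_left _ _, fun k hk => (min_le_right _ _).trans (Finset.inf'_le _ (by simp; omega))⟩
    exact (Finset.lt_inf'_iff _).2 fun k _ => hβ k
  obtain ⟨β', hβ', hβ0, hβk⟩ := hmin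
  refine ⟨β', hβ', fun b hb => ⟨h₀ b (hb.trans_le hβ0), ?_⟩⟩
  have h2 : CrNorm r ((fun t => η (t - b)) - η) ≤ 2 ^ r * (ε / 2 ^ r) := by
    refine CrNorm_le fun k hk t => ?_
    have hs := h₀ b (hb.trans_le hβ0)
    rw [iteratedDeriv_sub (hs.1.contDiffAt.of_le (by exact_mod_cast le_top))
        (hη.1.contDiffAt.of_le (by exact_mod_cast le_top)), iteratedDeriv_comp_sub_const]
    exact h k b (hb.trans_le (hβk k hk)) t
  rwa [mul_div_cancel₀ _ (by positivity)] at h2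

theorem VF_iterate_add {K : ℕ} {lam : ℂ} {f g : Heis → ℂ} (hf : IsCentralEigen K lam f)
    (hg : IsCentralEigen K lam g) (U : ℝ × ℝ × ℝ) (j : ℕ) :
    (VF U)^[j] (f + g) = (VF U)^[j] f + (VF U)^[j] g := by
  induction j with
  | zero => rfl
  | succ j ih =>
    simp only [Function.iterate_succ_apply', ih]
    exact VF_add (hf.vf_iterate U j).differentiable (hg.vf_iterate U j).differentiable U

theorem VF_iterate_smul {K : ℕ} {lam : ℂ} {f : Heis → ℂ} (hf : IsCentralEigen K lam f) (c : ℂ)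
    (U : ℝ × ℝ × ℝ) (j : ℕ) : (VF U)^[j] (c • f) = c • (VF U)^[j] f := by
  induction j with
  | zero => rfl
  | succ j ih =>
    simp only [Function.iterate_succ_apply', ih]
    exact VF_smul (hf.vf_iterate U j).differentiable c U

section ell

variable {W : ℝ × ℝ × ℝ} {δ : ℝ} {η ζ : ℝ → ℂ} {f g : Heis → ℂ}

theorem intervalIntegrable_ell (hη : Continuous η) (hf : Continuous f) (m : Heis) (a b : ℝ) :
    IntervalIntegrable (fun t => η t * f (hflow W t m)) volume a b := by
  refine Continuous.intervalIntegrable ?_ a b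
  exact hη.mul (hf.comp ((continuous_hflow W).comp (by fun_prop : Continuous fun t : ℝ => (t, m))))

theorem ell_add (hη : Continuous η) (hf : Continuous f) (hg : Continuous g) (m : Heis) :
    ell W δ η m (f + g) = ell W δ η m f + ell W δ η m g := by
  simp only [ell, Pi.add_apply, mul_add]
  exact intervalIntegral.integral_add (intervalIntegrable_ell hη hf m _ _)
    (intervalIntegrable_ell hη hg m _ _)

theorem ell_smul (c : ℂ) (m : Heis) : ell W δ η m (c • f) = c * ell W δ η m f := by
  simp only [ell, Pi.smul_apply, smul_eq_mul, mul_left_comm _ c]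
  exact intervalIntegral.integral_const_mul c _

theorem ell_sub_left (hη : Continuous η) (hζ : Continuous ζ) (hf : Continuous f) (m : Heis) :
    ell W δ (η - ζ) m f = ell W δ η m f - ell W δ ζ m f := by
  simp only [ell, Pi.sub_apply, sub_mul]
  exact intervalIntegral.integral_sub (intervalIntegrable_ell hη hf m _ _)
    (intervalIntegrable_ell hζ hf m _ _)

theorem ell_smul_left (c : ℂ) (m : Heis) : ell W δ (c • η) m f = c * ell W δ η m f := by
  simp only [ell, Pi.smul_apply, smul_eq_mul, mul_assoc]
  exact intervalIntegral.integral_const_mul c _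

theorem ell_hflow_eq_ell_comp_sub (hη : TestFun δ η) {b : ℝ}
    (hηb : TestFun δ fun t => η (t - b)) (m : Heis) :
    ell W δ η (hflow W b m) f = ell W δ (fun t => η (t - b)) m f := by
  have key : ∀ ζ : ℝ → ℂ, TestFun δ ζ → ∀ m, ell W δ ζ m f = ∫ t, ζ t * f (hflow W t m) := by
    intro ζ hζ m
    refine intervalIntegral.integral_eq_integral_of_support_subset fun t ht => ?_
    exact Set.Ioo_subset_Ioc_self (hζ.2.2 (subset_tsupport ζ (left_ne_zero_of_mul ht)))
  rw [key η hη, key _ hηb, ← integral_sub_right_eq_self (fun t => η t * f (hflow W t _)) b]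
  simp only [hflow_hflow, add_sub_cancel]

theorem ell_hmul {K : ℕ} {lam : ℂ} (hf : IsCentralEigen K lam f) {γ : Heis} (hγ : γ ∈ GammaK K)
    (m : Heis) : ell W δ η (hmul γ m) f = ell W δ η m f := by
  simp only [ell, hflow_hmul, hf.invariant γ hγ]

theorem norm_ell_hflow_Zvec {K : ℕ} {lam : ℂ} (hf : IsCentralEigen K lam f) (hlam : lam.re = 0)
    (c : ℝ) (m : Heis) : ‖ell W δ η (hflow Zvec c m) f‖ = ‖ell W δ η m f‖ := by
  have : ell W δ η (hflow Zvec c m) f = Complex.exp (lam * c) * ell W δ η m f := by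
    simp only [ell, hflow_Zvec_comm, hf.central, mul_left_comm _ (Complex.exp (lam * c))]
    exact intervalIntegral.integral_const_mul _ _
  rw [this, norm_mul, Complex.norm_exp]
  simp [hlam]

theorem norm_ell_le {C C' : ℝ} (hδ : 0 < δ) (hη : ∀ t, ‖η t‖ ≤ C') (hf : ∀ m, ‖f m‖ ≤ C)
    (m : Heis) : ‖ell W δ η m f‖ ≤ C' * C * (2 * δ) := by
  have h := intervalIntegral.norm_integral_le_of_norm_le_const (a := -δ) (b := δ)
    (f := fun t => η t * f (hflow W t m)) (C := C' * C) fun t _ => by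
      rw [norm_mul]
      exact mul_le_mul (hη t) (hf _) (norm_nonneg _) ((norm_nonneg _).trans (hη t))
  rwa [show |δ - -δ| = 2 * δ by rw [abs_of_pos (by linarith)]; ring] at h

/-- `A` bounds the functionals `ell η m` at `f`, relative to the `C^q` norm of `η`. -/
def EllBound (W : ℝ × ℝ × ℝ) (δ : ℝ) (q : ℕ) (A : ℝ) (f : Heis → ℂ) : Prop :=
  ∀ η, TestFun δ η → ∀ m, ‖ell W δ η m f‖ ≤ CrNorm q η * A

theorem bddAbove_pqNorm {K : ℕ} {lam : ℂ} (hf : IsCentralEigen K lam f) (hlam : lam.re = 0)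
    (hδ : 0 < δ) (V : ℝ × ℝ × ℝ) (p q : ℕ) :
    BddAbove {x : ℝ | ∃ j : ℕ, j ≤ p ∧ ∃ m : Heis, ∃ η : ℝ → ℂ, TestFun δ η ∧ CrNorm q η ≤ 1 ∧
      x = ‖ell W δ η m ((VF V)^[j] f)‖} := by
  choose C hC using fun j => (hf.vf_iterate V j).exists_norm_le hlam
  obtain ⟨M, hM⟩ := ((Set.finite_Iic p).image C).bddAbove
  refine ⟨1 * M * (2 * δ), ?_⟩
  rintro _ ⟨j, hj, m, η, hη, hη1, rfl⟩
  exact norm_ell_le hδ (fun t => (hη.norm_le_CrNorm q t).trans hη1)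
    (fun m => (hC j m).trans (hM ⟨j, hj, rfl⟩)) m

theorem pqNorm_nonneg (V W : ℝ × ℝ × ℝ) (δ : ℝ) (p q : ℕ) (f : Heis → ℂ) :
    0 ≤ pqNorm V W δ p q f := by
  refine Real.sSup_nonneg ?_
  rintro _ ⟨j, _, m, η, _, _, rfl⟩
  exact norm_nonneg _

theorem ellBound_pqNorm {K : ℕ} {lam : ℂ} (hf : IsCentralEigen K lam f) (hlam : lam.re = 0)
    (hδ : 0 < δ) (V : ℝ × ℝ × ℝ) {p j : ℕ} (q : ℕ) (hj : j ≤ p) :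
    EllBound W δ q (pqNorm V W δ p q f) ((VF V)^[j] f) := by
  intro η hη m
  rcases (CrNorm_nonneg q η).eq_or_lt with h0 | h0
  · have : η = 0 := by
      ext t
      simpa [← h0] using hη.norm_le_CrNorm q t
    simpa [this, ell] using mul_nonneg (CrNorm_nonneg q 0) (pqNorm_nonneg V W δ p q f)
  · set c := CrNorm q η
    have h1 : ‖ell W δ (((c⁻¹ : ℝ) : ℂ) • η) m ((VF V)^[j] f)‖ ≤ pqNorm V W δ p q f := by
      refine le_csSup (bddAbove_pqNorm hf hlam hδ V p q) ⟨j, hj, m, _, hη.smul _, ?_, rfl⟩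
      rw [CrNorm_smul, Complex.norm_real, Real.norm_of_nonneg (by positivity)]
      exact (inv_mul_cancel₀ h0.ne').le
    rw [ell_smul_left, norm_mul, Complex.norm_real, Real.norm_of_nonneg (by positivity),
      inv_mul_le_iff₀ h0] at h1
    exact h1

theorem norm_ell_hflow_sub_le {K : ℕ} {lam : ℂ} {V : ℝ × ℝ × ℝ} {q : ℕ} {A : ℝ}
    (hVW : hbracket V W = Zvec)
    (hlam : lam.re = 0) (hf : IsCentralEigen K lam f) (hA : EllBound W δ q A f)
    (hA' : EllBound W δ q A (VF V f)) (hη : TestFun δ η) (s : ℝ) (m : Heis) :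
    ‖ell W δ η (hflow V s m) f - ell W δ η m f‖ ≤
      (‖lam‖ * CrNorm q ((fun t : ℝ => (t : ℂ)) * η) + CrNorm q η) * A * |s| := by
  set η₁ : ℝ → ℂ := (fun t : ℝ => (t : ℂ)) * η with hη₁_def
  have hη₁ : TestFun δ η₁ := hη.mul_left Complex.ofRealCLM.contDiff
  have hηc : Continuous η := hη.1.continuous
  have hfc := hf.contDiff.continuous
  have hf'c := (hf.vf V).contDiff.continuous
  have hpt : ∀ t r : ℝ, HasDerivAt (fun r => f (hflow W t (hflow V r m)))
      (lam * t * f (hflow W t (hflow V r m)) + VF V f (hflow W t (hflow V r m))) r := by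
    intro t r
    have h1 : HasDerivAt (fun r : ℝ => Complex.exp (lam * ((r * t : ℝ) : ℂ)))
        (Complex.exp (lam * ((r * t : ℝ) : ℂ)) * (lam * t)) r := by
      refine HasDerivAt.cexp ?_
      have := (((hasDerivAt_id r).mul_const t).ofReal_comp).const_mul lam
      simpa using this
    have h2 := hasDerivAt_comp_hflow hf.differentiable V (hflow W t m) r
    simp only [hflow_comm hVW, hf.central, (hf.vf V).central]
    exact (h1.mul h2).congr_deriv (by ring)
  obtain ⟨C, hC⟩ := hf.exists_norm_le hlam
  obtain ⟨C', hC'⟩ := (hf.vf V).exists_norm_le hlam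
  have hC0 : 0 ≤ C := (norm_nonneg _).trans (hC 0)
  have hder : ∀ r : ℝ, HasDerivAt (fun r => ell W δ η (hflow V r m) f)
      (lam * ell W δ η₁ (hflow V r m) f + ell W δ η (hflow V r m) (VF V f)) r := by
    intro r
    have h := (intervalIntegral.hasDerivAt_integral_of_dominated_loc_of_deriv_le
      (μ := volume) (a := -δ) (b := δ) (s := Set.univ) (x₀ := r)
      (F := fun r t => η t * f (hflow W t (hflow V r m)))
      (F' := fun r t => η t * (lam * t * f (hflow W t (hflow V r m)) +
        VF V f (hflow W t (hflow V r m))))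
      (bound := fun t => ‖η t‖ * (‖lam‖ * |t| * C + C')) univ_mem
      (Eventually.of_forall fun r =>
        (intervalIntegrable_iff.1 (intervalIntegrable_ell hηc hfc _ _ _)).aestronglyMeasurable)
      (intervalIntegrable_ell hηc hfc _ _ _) ?_ ?_ ?_ ?_).2
    · refine h.congr_deriv ?_
      simp only [ell]
      rw [← intervalIntegral.integral_const_mul, ← intervalIntegral.integral_add
        ((intervalIntegrable_ell hη₁.1.continuous hfc _ _ _).const_mul _)
        (intervalIntegrable_ell hηc hf'c _ _ _)]
      refine intervalIntegral.integral_congr fun t _ => ?_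
      simp only [hη₁_def, Pi.mul_apply]
      ring
    · refine Continuous.aestronglyMeasurable ?_
      have hw : Continuous fun t : ℝ => hflow W t (hflow V r m) :=
        (continuous_hflow W).comp (by fun_prop : Continuous fun t : ℝ => (t, hflow V r m))
      have h1 := hfc.comp hw
      have h2 := hf'c.comp hw
      simp only [Function.comp_def] at h1 h2
      fun_prop
    · refine Eventually.of_forall fun t _ x _ => ?_
      rw [norm_mul]
      refine mul_le_mul_of_nonneg_left ((norm_add_le _ _).trans (add_le_add ?_ (hC' _)))
        (norm_nonneg _)
      rw [norm_mul, norm_mul, Complex.norm_real, Real.norm_eq_abs]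
      exact mul_le_mul_of_nonneg_left (hC _) (by positivity)
    · exact Continuous.intervalIntegrable (by fun_prop) _ _
    · exact Eventually.of_forall fun t _ x _ => (hpt t x).const_mul _
  have hmvt := convex_univ.norm_image_sub_le_of_norm_hasDerivWithin_le
    (f := fun r => ell W δ η (hflow V r m) f) (x := 0) (y := s)
    (C := (‖lam‖ * CrNorm q η₁ + CrNorm q η) * A)
    (fun r _ => (hder r).hasDerivWithinAt) (fun r _ => ?_) (Set.mem_univ _) (Set.mem_univ _)
  · simpa [hflow_zero] using hmvt
  · refine (norm_add_le _ _).trans ?_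
    rw [norm_mul, add_mul, mul_assoc]
    exact add_le_add (mul_le_mul_of_nonneg_left (hA _ hη₁ _) (norm_nonneg _)) (hA' _ hη _)

/-- For a fixed test function, finitely many base points control `ell η m f` for all `m`. -/
theorem exists_finite_base_net {V : ℝ × ℝ × ℝ} (hVW : hbracket V W = Zvec)
    (K : ℕ) {lam : ℂ} (hlam : lam.re = 0) (q : ℕ) (hη : TestFun δ η) {ε : ℝ} (hε : 0 < ε) :
    ∃ F : Set Heis, F.Finite ∧ ∀ (f : Heis → ℂ) (A : ℝ), 0 ≤ A → IsCentralEigen K lam f →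
      EllBound W δ q A f → EllBound W δ q A (VF V f) →
      ∀ m, ∃ m₀ ∈ F, ‖ell W δ η m f‖ ≤ ‖ell W δ η m₀ f‖ + ε * A := by
  have hdet : V.1 * W.2.1 - W.1 * V.2.1 = 1 := by simpa [hbracket, Zvec] using hVW
  obtain ⟨β, hβ, hβW⟩ := hη.exists_CrNorm_comp_sub_le q (half_pos hε)
  set D := ‖lam‖ * CrNorm q ((fun t : ℝ => (t : ℂ)) * η) + CrNorm q η
  have hD : 0 ≤ D := add_nonneg (mul_nonneg (norm_nonneg _) (CrNorm_nonneg _ _))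
    (CrNorm_nonneg _ _)
  set κ := |W.1| + |W.2.1| + |V.1| + |V.2.1| + 1 with hκ_def
  have hκ : 0 < κ := by positivity
  set ρ := min (ε / 2 / (D + 1)) β with hρ_def
  have hρ : 0 < ρ := lt_min (by positivity) hβ
  obtain ⟨G, -, hGf, hG⟩ := (isCompact_Icc.prod isCompact_Icc :
    IsCompact (Set.Icc (0 : ℝ) 1 ×ˢ Set.Icc (0 : ℝ) 1)).finite_cover_balls
      (div_pos hρ hκ)
  refine ⟨(fun z : ℝ × ℝ => ((z.1, z.2, 0) : Heis)) '' G, hGf.image _, ?_⟩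
  intro f A hA hf hAf hAVf m
  obtain ⟨γ, hγ, c, x, y, hx, hy, rfl⟩ := exists_lattice_reduction K m
  rw [ell_hmul hf hγ, norm_ell_hflow_Zvec hf hlam]
  have hxy := hG (Set.mk_mem_prod hx hy)
  simp only [Set.mem_iUnion, exists_prop] at hxy
  obtain ⟨⟨x₀, y₀⟩, hzG, hz⟩ := hxy
  refine ⟨_, ⟨_, hzG, rfl⟩, ?_⟩
  rw [Metric.mem_ball, Prod.dist_eq, max_lt_iff, Real.dist_eq, Real.dist_eq] at hz
  set a := (x - x₀) * W.2.1 - (y - y₀) * W.1 with ha_def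
  set b := V.1 * (y - y₀) - V.2.1 * (x - x₀) with hb_def
  have hρκ : ρ / κ * κ = ρ := div_mul_cancel₀ _ hκ.ne'
  have small : ∀ u v w z : ℝ, |u| < ρ / κ → |v| < ρ / κ → |w| + |z| + 1 ≤ κ →
      |u * w - v * z| < ρ := by
    intro u v w z hu hv hwz
    have h1 : |u * w - v * z| ≤ |u| * |w| + |v| * |z| := by
      simpa only [abs_mul] using abs_sub (u * w) (v * z)
    have h2 : |u| * |w| ≤ ρ / κ * |w| := mul_le_mul_of_nonneg_right hu.le (abs_nonneg _)
    have h3 : |v| * |z| ≤ ρ / κ * |z| := mul_le_mul_of_nonneg_right hv.le (abs_nonneg _)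
    have h4 : ρ / κ * (|w| + |z| + 1) ≤ ρ / κ * κ := mul_le_mul_of_nonneg_left hwz (by positivity)
    have h5 : 0 < ρ / κ := by positivity
    linarith
  have ha : |a| < ρ := small _ _ _ _ hz.1 hz.2 (by
    rw [hκ_def]; linarith [abs_nonneg V.1, abs_nonneg V.2.1])
  have hb : |b| < ρ := by
    have := small _ _ V.1 V.2.1 hz.2 hz.1 (by
      rw [hκ_def]; linarith [abs_nonneg W.1, abs_nonneg W.2.1])
    rwa [hb_def, mul_comm V.1, mul_comm V.2.1]
  obtain ⟨c', hc'⟩ : ∃ c', ((x, y, 0) : Heis) =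
      hflow Zvec c' (hflow W b (hflow V a (x₀, y₀, 0))) := by
    refine ⟨-(hflow W b (hflow V a (x₀, y₀, 0))).2.2, ?_⟩
    rw [hflow_Zvec, add_neg_cancel]
    simp only [hflow_eq, Prod.mk.injEq, and_true]
    constructor
    · linear_combination (-(x - x₀)) * hdet
    · linear_combination (-(y - y₀)) * hdet
  rw [hc', norm_ell_hflow_Zvec hf hlam]
  obtain ⟨hηb, hηbn⟩ := hβW b (hb.trans_le (min_le_right _ _))
  have hstepW : ‖ell W δ η (hflow W b (hflow V a (x₀, y₀, 0))) f -
      ell W δ η (hflow V a (x₀, y₀, 0)) f‖ ≤ ε / 2 * A := by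
    rw [ell_hflow_eq_ell_comp_sub hη hηb, ← ell_sub_left hηb.1.continuous hη.1.continuous
      hf.contDiff.continuous]
    exact (hAf _ (hηb.sub hη) _).trans (mul_le_mul_of_nonneg_right hηbn hA)
  have hstepV : ‖ell W δ η (hflow V a (x₀, y₀, 0)) f - ell W δ η (x₀, y₀, 0) f‖ ≤
      ε / 2 * A := by
    refine (norm_ell_hflow_sub_le hVW hlam hf hAf hAVf hη a _).trans ?_
    rw [mul_right_comm]
    refine mul_le_mul_of_nonneg_right ?_ hA
    have h1 : |a| ≤ ε / 2 / (D + 1) := ha.le.trans (min_le_left _ _)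
    rw [le_div_iff₀ (by positivity)] at h1
    change D * |a| ≤ ε / 2
    nlinarith [abs_nonneg a]
  have h1 := norm_le_norm_add_norm_sub' (ell W δ η (hflow W b (hflow V a (x₀, y₀, 0))) f)
    (ell W δ η (hflow V a (x₀, y₀, 0)) f)
  have h2 := norm_le_norm_add_norm_sub' (ell W δ η (hflow V a (x₀, y₀, 0)) f)
    (ell W δ η (x₀, y₀, 0) f)
  linarith

end ell

/-- The space `C^∞_N` as a complex vector space. -/
def CNSubmodule (K : ℕ) (N : ℤ) : Submodule ℂ (Heis → ℂ) where
  carrier := {h | CN K N h}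
  zero_mem' := by
    refine ⟨⟨contDiff_const, fun _ _ _ => rfl⟩, ?_⟩
    ext m
    simp [VF]
  add_mem' {f g} hf hg := by
    refine ⟨⟨hf.1.1.add hg.1.1, fun γ hγ m => ?_⟩, ?_⟩
    · simp only [Pi.add_apply, hf.1.2 γ hγ, hg.1.2 γ hγ]
    · rw [VF_add hf.isCentralEigen.differentiable hg.isCentralEigen.differentiable, hf.2, hg.2]
      ext m
      simp only [Pi.add_apply]
      ring
  smul_mem' c f hf := by
    refine ⟨⟨hf.1.1.const_smul c, fun γ hγ m => ?_⟩, ?_⟩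
    · simp only [Pi.smul_apply, hf.1.2 γ hγ]
    · rw [VF_smul hf.isCentralEigen.differentiable, hf.2]
      ext m
      simp only [Pi.smul_apply, smul_eq_mul]
      ring

/-- The linear functional `h ↦ ell η m (V^j h)` on `C^∞_N`. -/
def ellFunctional {K : ℕ} {N : ℤ} (V W : ℝ × ℝ × ℝ) (δ : ℝ) {η : ℝ → ℂ} (hη : Continuous η)
    (m : Heis) (j : ℕ) : CNSubmodule K N →ₗ[ℂ] ℂ where
  toFun h := ell W δ η m ((VF V)^[j] h)
  map_add' f g := by
    have hf := CN.isCentralEigen f.2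
    have hg := CN.isCentralEigen g.2
    rw [Submodule.coe_add, VF_iterate_add hf hg, ell_add hη
      (hf.vf_iterate V j).contDiff.continuous (hg.vf_iterate V j).contDiff.continuous]
  map_smul' c f := by
    rw [Submodule.coe_smul, VF_iterate_smul (CN.isCentralEigen f.2), ell_smul]
    rfl

/-- Up to an arbitrarily small multiple of the strong norm, the weak norm is controlled by
finitely many of the functionals `ell η m ∘ V^j`. -/
theorem exists_finite_ell_net {V W : ℝ × ℝ × ℝ} (hVW : hbracket V W = Zvec) {δ : ℝ} (hδ : 0 < δ)
    (K : ℕ) {lam : ℂ} (hlam : lam.re = 0) {p p' q q' : ℕ} (hp : p < p') (hq : q' < q) {ε : ℝ}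
    (hε : 0 < ε) :
    ∃ P : Set ((ℝ → ℂ) × Heis), P.Finite ∧ (∀ z ∈ P, TestFun δ z.1 ∧ CrNorm q z.1 ≤ 1) ∧
      ∀ f, IsCentralEigen K lam f → ∀ j ≤ p, ∀ η, TestFun δ η → CrNorm q η ≤ 1 → ∀ m,
        ∃ z ∈ P, ‖ell W δ η m ((VF V)^[j] f)‖ ≤
          ‖ell W δ z.1 z.2 ((VF V)^[j] f)‖ + ε * pqNorm V W δ p' q' f := by
  obtain ⟨G, hGf, hG, hGnet⟩ := exists_finite_CrNorm_net (δ := δ) hq (half_pos hε)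
  have hbase : ∀ ζ : G, ∃ F : Set Heis, F.Finite ∧ ∀ (f : Heis → ℂ) (A : ℝ), 0 ≤ A →
      IsCentralEigen K lam f → EllBound W δ q' A f → EllBound W δ q' A (VF V f) →
      ∀ m, ∃ m₀ ∈ F, ‖ell W δ ζ m f‖ ≤ ‖ell W δ ζ m₀ f‖ + ε / 2 * A := fun ζ =>
    exists_finite_base_net hVW K hlam q' (hG ζ ζ.2).1 (half_pos hε)
  choose F hFf hF using hbase
  have := hGf.to_subtype
  refine ⟨⋃ ζ : G, Prod.mk (ζ : ℝ → ℂ) '' F ζ, Set.finite_iUnion fun ζ => (hFf ζ).image _, ?_, ?_⟩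
  · intro z hz
    obtain ⟨ζ, m, -, rfl⟩ := Set.mem_iUnion.1 hz
    exact hG ζ ζ.2
  · intro f hf j hj η hη hη1 m
    obtain ⟨ζ, hζG, hζ⟩ := hGnet η hη hη1
    have hζT := (hG ζ hζG).1
    have hb := ellBound_pqNorm (W := W) hf hlam hδ V q' (hj.trans hp.le)
    have hb' := ellBound_pqNorm (W := W) hf hlam hδ V q' (Nat.succ_le_of_lt (hj.trans_lt hp))
    rw [Function.iterate_succ_apply'] at hb'
    have hfj := hf.vf_iterate V j
    have hnn := pqNorm_nonneg V W δ p' q' f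
    obtain ⟨m₀, hm₀, hle⟩ := hF ⟨ζ, hζG⟩ _ _ hnn hfj hb hb' m
    refine ⟨(ζ, m₀), Set.mem_iUnion.2 ⟨⟨ζ, hζG⟩, m₀, hm₀, rfl⟩, ?_⟩
    have h1 : ‖ell W δ η m ((VF V)^[j] f) - ell W δ ζ m ((VF V)^[j] f)‖ ≤
        ε / 2 * pqNorm V W δ p' q' f := by
      rw [← ell_sub_left hη.1.continuous hζT.1.continuous hfj.contDiff.continuous]
      exact (hb _ (hη.sub hζT) m).trans (mul_le_mul_of_nonneg_right hζ hnn)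
    have h2 := norm_le_norm_add_norm_sub' (ell W δ η m ((VF V)^[j] f))
      (ell W δ ζ m ((VF V)^[j] f))
    simp only at hle ⊢
    linarith

/-- A completion map of `C^∞_N` as a linear map. -/
def IsCompletion.linearMap {Nrm : (Heis → ℂ) → ℝ} {K : ℕ} {N : ℤ} {B : Type}
    [NormedAddCommGroup B] [NormedSpace ℂ B] {j : (Heis → ℂ) → B}
    (h : IsCompletion Nrm {f | CN K N f} j) : CNSubmodule K N →ₗ[ℂ] B where
  toFun f := j f
  map_add' f g := h.2.1 f f.2 g g.2
  map_smul' c f := h.2.2.1 c f f.2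

/-- **Lemma 2.5 (compact embedding).** For `p < p'` and `q' < q` the canonical
inclusion `B^{p',q'}_N ⊆ B^{p,q}_N` is a compact operator. -/
theorem compact_embedding (S : NilSetting) (N : ℤ) (p p' q q' : ℕ)
    (hq' : 1 ≤ q') (hpp : p < p') (hqq : q' < q)
    (B : Type) [NormedAddCommGroup B] [NormedSpace ℂ B] (j : (Heis → ℂ) → B)
    (B' : Type) [NormedAddCommGroup B'] [NormedSpace ℂ B'] (j' : (Heis → ℂ) → B')
    (hB : IsCompletion (S.nrm p q) (S.cn N) j)
    (hB' : IsCompletion (S.nrm p' q') (S.cn N) j') :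
    ∃ T : B' →L[ℂ] B, (∀ h ∈ S.cn N, T (j' h) = j h) ∧ IsCompactOperator T := by
  have := hB.1
  have hlam : (2 * Real.pi * Complex.I * N * S.K : ℂ).re = 0 := by simp
  have hJ : ∀ h : CNSubmodule S.K N, ‖hB.linearMap h‖ = pqNorm S.Vd S.Wd S.δ p q h :=
    fun h => hB.2.2.2.1 h h.2
  have hJ' : ∀ h : CNSubmodule S.K N, ‖hB'.linearMap h‖ = pqNorm S.Vd S.Wd S.δ p' q' h :=
    fun h => hB'.2.2.2.1 h h.2
  have hdense : DenseRange hB'.linearMap := by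
    refine hB'.2.2.2.2.mono ?_
    rintro _ ⟨h, hh, rfl⟩
    exact ⟨⟨h, hh⟩, rfl⟩
  suffices H : ∀ ε > 0, ∃ (ι : Type) (_ : Fintype ι)
      (Λ : CNSubmodule S.K N →ₗ[ℂ] (ι → ℂ)), ∀ h, ‖Λ h‖ ≤ ‖hB'.linearMap h‖ ∧
        ‖hB.linearMap h‖ ≤ ‖Λ h‖ + ε * ‖hB'.linearMap h‖ by
    obtain ⟨T, hT, hTc⟩ := exists_compact_extension hB.linearMap hB'.linearMap hdense H
    exact ⟨T, fun h hh => hT ⟨h, hh⟩, hTc⟩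
  intro ε hε
  obtain ⟨P, hPf, hP, hPnet⟩ :=
    exists_finite_ell_net S.frame S.hδ S.K hlam hpp hqq hε
  have := hPf.fintype
  refine ⟨Fin (p + 1) × P, inferInstance, LinearMap.pi fun i =>
    ellFunctional S.Vd S.Wd S.δ (hP i.2 i.2.2).1.1.continuous (i.2 : (ℝ → ℂ) × Heis).2 i.1,
    fun h => ?_⟩
  have hh := CN.isCentralEigen h.2
  have hnn := pqNorm_nonneg S.Vd S.Wd S.δ p' q' h
  rw [hJ, hJ']
  refine ⟨(pi_norm_le_iff_of_nonneg hnn).2 fun i => ?_, ?_⟩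
  · have hz := hP i.2 i.2.2
    have h1 := ellBound_pqNorm (W := S.Wd) hh hlam S.hδ S.Vd q'
      (show (i.1 : ℕ) ≤ p' by omega) _ hz.1 (i.2 : (ℝ → ℂ) × Heis).2
    exact h1.trans (mul_le_of_le_one_left hnn ((CrNorm_mono hqq.le _).trans hz.2))
  · refine Real.sSup_le ?_ (by positivity)
    rintro _ ⟨k, hk, m, η, hη, hη1, rfl⟩
    obtain ⟨z, hz, hle⟩ := hPnet h hh k hk η hη hη1 m
    refine hle.trans (add_le_add_left ?_ _)
    exact norm_le_pi_norm (LinearMap.pi (fun i : Fin (p + 1) × P =>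
      ellFunctional S.Vd S.Wd S.δ (hP i.2 i.2.2).1.1.continuous (i.2 : (ℝ → ℂ) × Heis).2 i.1) h)
      (⟨k, by omega⟩, ⟨z, hz⟩)
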